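/- Let 𝒢 = {(⊢ x : C_{i,1}, …, x : C_{i,k_i}) | 1 ≤ i ≤ n} be an interpolant all of whose members have empty antecedent and use only the single label x, and let ⊓⊔𝒢 denote the concept ⊓_{1≤i≤n} ⊔_{1≤j≤k_i} C_{i,j}. If the sequent Γ ⊢ Δ, Σ is provable in S(O) for every (⊢ Σ) ∈ 𝒢^⊥, then S(O) ⊩ Γ ⊢ Δ, x : ¬̇(⊓⊔𝒢). -/

import Mathlib

set_option maxHeartbeats 1000000

namespace RIQ

/-- Roles: role names and inverse roles. -/
inductive Role : Type
  | name : ℕ → Role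
  | inv  : ℕ → Role
deriving DecidableEq

/-- The inverse of a role. -/
def Role.invert : Role → Role
  | .name r => .inv r
  | .inv r  => .name r

/-- RIQ concepts in negation normal form. -/
inductive Concept : Type
  | atom : ℕ → Concept
  | nneg : ℕ → Concept
  | inter : Concept → Concept → Concept
  | union : Concept → Concept → Concept
  | ex : Role → Concept → Concept
  | all : Role → Concept → Concept
  | atMost : ℕ → Role → Concept → Concept
  | atLeast : ℕ → Role → Concept → Concept
deriving DecidableEq

/-- ⊤ := A₀ ⊔ ¬A₀ for the fixed concept name A₀ = 0. -/
def topC : Concept := .union (.atom 0) (.nneg 0)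

/-- ⊥ := A₀ ⊓ ¬A₀ for the fixed concept name A₀ = 0. -/
def botC : Concept := .inter (.atom 0) (.nneg 0)

/-- NNF-negation. -/
def nnfNeg : Concept → Concept
  | .atom A => .nneg A
  | .nneg A => .atom A
  | .inter C D => .union (nnfNeg C) (nnfNeg D)
  | .union C D => .inter (nnfNeg C) (nnfNeg D)
  | .ex r C => .all r (nnfNeg C)
  | .all r C => .ex r (nnfNeg C)
  | .atMost n r C => .atLeast (n+1) r C
  | .atLeast 0 _ _ => botC
  | .atLeast (n+1) r C => .atMost n r C

/-- Literals: concept names and their negations. -/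
def IsLiteral : Concept → Prop
  | .atom _ => True
  | .nneg _ => True
  | _ => False

/-- A complex role inclusion axiom r₁ ∘ ⋯ ∘ rₙ ⊑ s. -/
structure RIA where
  lhs : List Role
  rhs : Role
deriving DecidableEq

/-- An ontology: a finite set of RIAs (RBox) together with a finite set of
GCIs (TBox), each GCI ⊤ ⊑ C being recorded by its right-hand concept C. -/
structure Ontology where
  rias : Finset RIA
  gcis : Finset Concept

/-- Union of two ontologies. -/
def Ontology.union (O₁ O₂ : Ontology) : Ontology := ⟨O₁.rias ∪ O₂.rias, O₁.gcis ∪ O₂.gcis⟩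

/-- Concept names occurring in a concept. -/
def cnames : Concept → Finset ℕ
  | .atom A => {A}
  | .nneg A => {A}
  | .inter C D => cnames C ∪ cnames D
  | .union C D => cnames C ∪ cnames D
  | .ex _ C => cnames C
  | .all _ C => cnames C
  | .atMost _ _ C => cnames C
  | .atLeast _ _ C => cnames C

/-- Concept names occurring in an ontology. -/
def Ontology.cnames (O : Ontology) : Finset ℕ := O.gcis.sup RIQ.cnames

/-- An interpretation over the domain δ. -/
structure Interp (δ : Type) where
  cI : ℕ → Set δ
  rI : ℕ → Set (δ × δ)

/-- Interpretation of roles. -/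
def Interp.roleI {δ : Type} (I : Interp δ) : Role → Set (δ × δ)
  | .name r => I.rI r
  | .inv r  => {p | (p.2, p.1) ∈ I.rI r}

/-- Relational composition of a list of roles (empty composition is the identity). -/
def Interp.listComp {δ : Type} (I : Interp δ) : List Role → Set (δ × δ)
  | [] => {p | p.1 = p.2}
  | r :: rs => {p | ∃ b, (p.1, b) ∈ I.roleI r ∧ (b, p.2) ∈ I.listComp rs}

/-- Interpretation of concepts. -/
def Interp.cInterp {δ : Type} (I : Interp δ) : Concept → Set δ
  | .atom A => I.cI A
  | .nneg A => (I.cI A)ᶜ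
  | .inter C D => I.cInterp C ∩ I.cInterp D
  | .union C D => I.cInterp C ∪ I.cInterp D
  | .ex r C => {a | ∃ b, (a, b) ∈ I.roleI r ∧ b ∈ I.cInterp C}
  | .all r C => {a | ∀ b, (a, b) ∈ I.roleI r → b ∈ I.cInterp C}
  | .atMost n r C => {a | {b | (a, b) ∈ I.roleI r ∧ b ∈ I.cInterp C}.encard ≤ (n : ℕ∞)}
  | .atLeast n r C => {a | (n : ℕ∞) ≤ {b | (a, b) ∈ I.roleI r ∧ b ∈ I.cInterp C}.encard}

/-- I ⊨ O. -/
def Interp.models {δ : Type} (I : Interp δ) (O : Ontology) : Prop :=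
  (∀ C ∈ O.gcis, I.cInterp topC ⊆ I.cInterp C) ∧
  (∀ ria ∈ O.rias, I.listComp ria.lhs ⊆ I.roleI ria.rhs)

/-- O ⊨ C ⊑ D. -/
def entails (O : Ontology) (C D : Concept) : Prop :=
  ∀ (δ : Type) [Nonempty δ] (I : Interp δ), I.models O → I.cInterp C ⊆ I.cInterp D

/-- Production rules of the R-system G(O). -/
def ProdRule (O : Ontology) (s : Role) (T : List Role) : Prop :=
  ∃ ria ∈ O.rias, (s = ria.rhs ∧ T = ria.lhs) ∨
    (s = ria.rhs.invert ∧ T = (ria.lhs.map Role.invert).reverse)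

/-- One-step derivation in the R-system G(O). -/
def OneStep (O : Ontology) (S R : List Role) : Prop :=
  ∃ S' s T R', ProdRule O s T ∧ S = S' ++ s :: R' ∧ R = S' ++ T ++ R'

/-- The language L_{G(O)}(r). -/
def lang (O : Ontology) (r : Role) : Set (List Role) :=
  {S | Relation.ReflTransGen (OneStep O) [r] S}

/-- Structural atoms: role atoms, equality atoms and inequality atoms
(labels are natural numbers). -/
inductive SAtom : Type
  | rel : Role → ℕ → ℕ → SAtom
  | eq : ℕ → ℕ → SAtom
  | neq : ℕ → ℕ → SAtom
deriving DecidableEq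

/-- Labels occurring in a structural atom. -/
def SAtom.labels : SAtom → Finset ℕ
  | .rel _ x y => {x, y}
  | .eq x y => {x, y}
  | .neq x y => {x, y}

/-- Labeled concepts. -/
abbrev LC := ℕ × Concept

/-- Labels occurring in a finite set of structural atoms. -/
def labSetF (Γ : Finset SAtom) : Finset ℕ := Γ.biUnion SAtom.labels

/-- Labels occurring in a multiset of labeled concepts. -/
def Δlabels (Δ : Multiset LC) : Finset ℕ := (Δ.map Prod.fst).toFinset

/-- One step of the equality chain x ≈ y (an equality atom in either orientation). -/
def eqStep (Γ : Set SAtom) (x y : ℕ) : Prop := SAtom.eq x y ∈ Γ ∨ SAtom.eq y x ∈ Γ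

/-- x ∼_Γ y : x and y are linked by a finite chain of equality atoms of Γ. -/
def eqRel (Γ : Set SAtom) : ℕ → ℕ → Prop := Relation.ReflTransGen (eqStep Γ)

/-- Edge of the propagation graph PG(Γ) between the classes of x and y, labeled r. -/
def pgEdge (Γ : Set SAtom) (x : ℕ) (r : Role) (y : ℕ) : Prop :=
  (∃ z w, eqRel Γ x z ∧ eqRel Γ y w ∧ SAtom.rel r z w ∈ Γ) ∨
  (∃ z w, eqRel Γ y z ∧ eqRel Γ x w ∧ SAtom.rel r.invert z w ∈ Γ)

/-- Propagation paths: PG(Γ) ⊨ [x]_Γ ⟶^S [y]_Γ for a string S of roles. -/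
def pgPath (Γ : Set SAtom) : List Role → ℕ → ℕ → Prop
  | [], x, y => eqRel Γ x y
  | r :: S, x, y => ∃ z, pgEdge Γ x r z ∧ pgPath Γ S z y

/-- PG(Γ) ⊨ [x]_Γ ⟶^L [y]_Γ with L = L_{G(O)}(r). -/
def pgLang (Γ : Set SAtom) (O : Ontology) (r : Role) (x y : ℕ) : Prop :=
  ∃ S ∈ lang O r, pgPath Γ S x y

/-- The edge relation of the directed graph determined by the role atoms of Γ. -/
def edgeRel (Γ : Set SAtom) (x y : ℕ) : Prop := ∃ r, SAtom.rel r x y ∈ Γ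

/-- Γ forms a (directed) tree. -/
def FormsTree (Γ : Finset SAtom) : Prop :=
  Γ = ∅ ∨ ∃ root ∈ labSetF Γ,
    (∀ x ∈ labSetF Γ, Relation.ReflTransGen (edgeRel ↑Γ) root x) ∧
    (∀ y, ¬ edgeRel ↑Γ y root) ∧
    (∀ x y y', edgeRel ↑Γ y x → edgeRel ↑Γ y' x → y = y')

/-- Γ ⊢ Δ is a sequent. -/
def IsSequent (Γ : Finset SAtom) (Δ : Multiset LC) : Prop :=
  FormsTree Γ ∧
  (Γ ≠ ∅ → ∀ p ∈ Δ, p.1 ∈ labSetF Γ) ∧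
  (Γ = ∅ → ∃ x, Δlabels Δ = {x})

/-- y : O̅, the multiset of labeled concepts y : ¬̇C for the GCIs ⊤ ⊑ C of O. -/
def obar (O : Ontology) (y : ℕ) : Multiset LC := O.gcis.val.map (fun C => (y, nnfNeg C))

/-- x : O̅ for every label x in a given finite set of labels. -/
def obarFor (O : Ontology) (ls : Finset ℕ) : Multiset LC := ls.val.bind (obar O)

/-- y is fresh, i.e. does not occur in the sequent Γ ⊢ Δ. -/
def FreshLabel (y : ℕ) (Γ : Finset SAtom) (Δ : Multiset LC) : Prop :=
  y ∉ labSetF Γ ∧ ∀ p ∈ Δ, p.1 ≠ y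

/-- The set {yᵢ ≠̇ yⱼ | i < j}. -/
def neqSet {n : ℕ} (ys : Fin n → ℕ) : Finset SAtom :=
  ((Finset.univ : Finset (Fin n × Fin n)).filter (fun p => p.1 < p.2)).image
    (fun p => SAtom.neq (ys p.1) (ys p.2))

/-- The set {r(x, yᵢ) | i}. -/
def relSet {n : ℕ} (r : Role) (x : ℕ) (ys : Fin n → ℕ) : Finset SAtom :=
  (Finset.univ : Finset (Fin n)).image (fun i => SAtom.rel r x (ys i))

/-- The multiset y₀ : ¬̇C, y₀ : O̅, …, yₙ : ¬̇C, yₙ : O̅. -/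
def leΔ (O : Ontology) (C : Concept) {n : ℕ} (ys : Fin n → ℕ) : Multiset LC :=
  ∑ i : Fin n, ((ys i, nnfNeg C) ::ₘ obar O (ys i))

/-- The sequent calculus S(O): `Deriv O Γ Δ n` states that the sequent Γ ⊢ Δ has
a proof in S(O) of height at most n. -/
inductive Deriv (O : Ontology) : Finset SAtom → Multiset LC → ℕ → Prop
  | id (Γ : Finset SAtom) (Δ : Multiset LC) (x A : ℕ) (n : ℕ) :
      Deriv O Γ ((x, Concept.atom A) ::ₘ (x, Concept.nneg A) ::ₘ Δ) n
  | idEq (Γ : Finset SAtom) (Δ : Multiset LC) (x y : ℕ) (n : ℕ)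
      (hmem : SAtom.neq x y ∈ Γ) (h : eqRel ↑Γ x y) :
      Deriv O Γ Δ n
  | subst (Γ : Finset SAtom) (Δ : Multiset LC) (x y : ℕ) (L : Concept) (n : ℕ)
      (hL : IsLiteral L) (h : eqRel ↑Γ x y)
      (p : Deriv O Γ ((x, L) ::ₘ (y, L) ::ₘ Δ) n) :
      Deriv O Γ ((x, L) ::ₘ Δ) (n + 1)
  | orR (Γ : Finset SAtom) (Δ : Multiset LC) (x : ℕ) (C D : Concept) (n : ℕ)
      (p : Deriv O Γ ((x, C) ::ₘ (x, D) ::ₘ Δ) n) :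
      Deriv O Γ ((x, Concept.union C D) ::ₘ Δ) (n + 1)
  | andR (Γ : Finset SAtom) (Δ : Multiset LC) (x : ℕ) (C D : Concept) (n : ℕ)
      (p : Deriv O Γ ((x, C) ::ₘ Δ) n) (q : Deriv O Γ ((x, D) ::ₘ Δ) n) :
      Deriv O Γ ((x, Concept.inter C D) ::ₘ Δ) (n + 1)
  | exR (Γ : Finset SAtom) (Δ : Multiset LC) (x y : ℕ) (r : Role) (C : Concept) (n : ℕ)
      (h : pgLang ↑Γ O r x y)
      (p : Deriv O Γ ((x, Concept.ex r C) ::ₘ (y, C) ::ₘ Δ) n) :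
      Deriv O Γ ((x, Concept.ex r C) ::ₘ Δ) (n + 1)
  | allR (Γ : Finset SAtom) (Δ : Multiset LC) (x y : ℕ) (r : Role) (C : Concept) (n : ℕ)
      (hy : FreshLabel y Γ ((x, Concept.all r C) ::ₘ Δ))
      (p : Deriv O (insert (SAtom.rel r x y) Γ) ((y, C) ::ₘ (obar O y + Δ)) n) :
      Deriv O Γ ((x, Concept.all r C) ::ₘ Δ) (n + 1)
  | leR (Γ : Finset SAtom) (Δ : Multiset LC) (x : ℕ) (r : Role) (C : Concept)
      (k : ℕ) (n : ℕ) (ys : Fin (k + 1) → ℕ)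
      (hinj : Function.Injective ys)
      (hfresh : ∀ i, FreshLabel (ys i) Γ ((x, Concept.atMost k r C) ::ₘ Δ))
      (p : Deriv O (Γ ∪ neqSet ys ∪ relSet r x ys) (leΔ O C ys + Δ) n) :
      Deriv O Γ ((x, Concept.atMost k r C) ::ₘ Δ) (n + 1)
  | geR (Γ : Finset SAtom) (Δ : Multiset LC) (x : ℕ) (r : Role) (C : Concept)
      (k : ℕ) (n : ℕ) (ys : Fin k → ℕ)
      (hpath : ∀ i, pgLang ↑Γ O r x (ys i))
      (p : ∀ i, Deriv O Γ ((ys i, C) ::ₘ (x, Concept.atLeast k r C) ::ₘ Δ) n)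
      (q : ∀ i j : Fin k, i < j →
        Deriv O (insert (SAtom.eq (ys i) (ys j)) Γ) ((x, Concept.atLeast k r C) ::ₘ Δ) n) :
      Deriv O Γ ((x, Concept.atLeast k r C) ::ₘ Δ) (n + 1)

/-- S(O) ⊩ Γ ⊢ Δ. -/
def SProvable (O : Ontology) (Γ : Finset SAtom) (Δ : Multiset LC) : Prop := ∃ n, Deriv O Γ Δ n

/-- Satisfaction of a structural atom under a label assignment. -/
def satAtom {δ : Type} (I : Interp δ) (lam : ℕ → δ) : SAtom → Prop
  | .rel r x y => (lam x, lam y) ∈ I.roleI r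
  | .eq x y => lam x = lam y
  | .neq x y => lam x ≠ lam y

/-- I, λ ⊨^∀ Γ. -/
def satAll {δ : Type} (I : Interp δ) (lam : ℕ → δ) (Γ : Set SAtom) : Prop :=
  ∀ a ∈ Γ, satAtom I lam a

/-- I, λ ⊨^∃ Δ. -/
def satEx {δ : Type} (I : Interp δ) (lam : ℕ → δ) (Δ : Multiset LC) : Prop :=
  ∃ p ∈ Δ, lam p.1 ∈ I.cInterp p.2

/-- ⊨_O Γ ⊢ Δ : validity of a sequent relative to O. -/
def ValidSeq (O : Ontology) (Γ : Finset SAtom) (Δ : Multiset LC) : Prop :=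
  ∀ (δ : Type) [Nonempty δ] (I : Interp δ) (lam : ℕ → δ),
    I.models O → satAll I lam ↑Γ → satEx I lam Δ

/-- Label substitution (x/y) on labels: replace y by x. -/
def substLab (x y z : ℕ) : ℕ := if z = y then x else z

/-- Label substitution (x/y) on structural atoms. -/
def SAtom.substL (x y : ℕ) : SAtom → SAtom
  | .rel r a b => .rel r (substLab x y a) (substLab x y b)
  | .eq a b => .eq (substLab x y a) (substLab x y b)
  | .neq a b => .neq (substLab x y a) (substLab x y b)

/-- Label substitution (x/y) on the antecedent. -/
def substΓ (x y : ℕ) (Γ : Finset SAtom) : Finset SAtom := Γ.image (SAtom.substL x y)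

/-- Label substitution (x/y) on the consequent. -/
def substΔ (x y : ℕ) (Δ : Multiset LC) : Multiset LC := Δ.map (fun p => (substLab x y p.1, p.2))

/-- Exactly one of three propositions holds. -/
def XOr3 (a b c : Prop) : Prop := (a ∧ ¬b ∧ ¬c) ∨ (¬a ∧ b ∧ ¬c) ∨ (¬a ∧ ¬b ∧ c)

/-- A member Γᵢ ⊢ Δᵢ of an interpolant. -/
abbrev ISeq := (Finset SAtom) × (Finset LC)

/-- 𝒢 is an interpolant: every member's antecedent consists of equality and
inequality atoms between distinct labels. -/
def IsInterpolant (G : Finset ISeq) : Prop :=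
  ∀ p ∈ G, ∀ a ∈ p.1, ∃ x y : ℕ, x ≠ y ∧ (a = SAtom.eq x y ∨ a = SAtom.neq x y)

/-- The orthogonality condition between a member p of 𝒢 and a candidate q. -/
def orthCond (p q : ISeq) : Prop :=
  XOr3 (∃ x y, SAtom.eq x y ∈ q.1 ∧ SAtom.neq x y ∈ p.1)
       (∃ x y, SAtom.neq x y ∈ q.1 ∧ SAtom.eq x y ∈ p.1)
       (∃ x C, (x, nnfNeg C) ∈ q.2 ∧ (x, C) ∈ p.2)

/-- The orthogonal 𝒢^⊥. -/
def OrthP (G : Set ISeq) : Set ISeq := {q | ∀ p ∈ G, orthCond p q}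

/-- Labels occurring in a member of an interpolant. -/
def iseqLabels (p : ISeq) : Finset ℕ := labSetF p.1 ∪ p.2.image Prod.fst

/-- Concept names occurring in a multiset of labeled concepts. -/
def ΔcnamesS (Δ : Multiset LC) : Set ℕ := {A | ∃ p ∈ Δ, A ∈ cnames p.2}

/-- Disjunction of a list of concepts. -/
def bigUnionL : List Concept → Concept
  | [] => botC
  | [C] => C
  | C :: D :: L => .union C (bigUnionL (D :: L))

/-- Conjunction of a list of concepts. -/
def bigInterL : List Concept → Concept
  | [] => topC
  | [C] => C
  | C :: D :: L => .inter C (bigInterL (D :: L))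

/-- ⊓⊔𝒢 : the conjunction of the disjunctions of the members of 𝒢. -/
def interUnion (G : List (List Concept)) : Concept := bigInterL (G.map bigUnionL)

/-- The interpolant {(⊢ x : C_{i,1}, …, x : C_{i,k_i}) | 1 ≤ i ≤ n}, as a set of ISeqs. -/
def simpleG (x : ℕ) (G : List (List Concept)) : Set ISeq :=
  {p | ∃ S ∈ G, p = (∅, (S.map (fun C => (x, C))).toFinset)}

/-- Renaming of concept names in a concept. -/
def renameC (ρ : ℕ → ℕ) : Concept → Concept
  | .atom A => .atom (ρ A)
  | .nneg A => .nneg (ρ A)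
  | .inter C D => .inter (renameC ρ C) (renameC ρ D)
  | .union C D => .union (renameC ρ C) (renameC ρ D)
  | .ex r C => .ex r (renameC ρ C)
  | .all r C => .all r (renameC ρ C)
  | .atMost n r C => .atMost n r (renameC ρ C)
  | .atLeast n r C => .atLeast n r (renameC ρ C)

/-- Renaming of concept names in an ontology. -/
def renameO (ρ : ℕ → ℕ) (O : Ontology) : Ontology := ⟨O.rias, O.gcis.image (renameC ρ)⟩

/-- C is implicitly concept-definable from Θ under O. -/
def ImplicitlyDefinable (C : Concept) (O : Ontology) (Θ : Finset ℕ) : Prop :=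
  ∀ (δ : Type) [Nonempty δ] (I J : Interp δ), I.models O → J.models O →
    (∀ r, I.rI r = J.rI r) → (∀ A ∈ Θ, I.cI A = J.cI A) →
    I.cInterp C = J.cInterp C

/-- C is explicitly concept-definable from Θ under O. -/
def ExplicitlyDefinable (C : Concept) (O : Ontology) (Θ : Finset ℕ) : Prop :=
  ∃ D : Concept, cnames D ⊆ Θ ∧ entails O C D ∧ entails O D C

/-- RIQ has the concept interpolation property. -/
def ConceptInterpolationProperty : Prop :=
  ∀ (O₁ O₂ : Ontology) (C D : Concept), entails (O₁.union O₂) C D →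
    ∃ I : Concept, cnames I ⊆ (cnames C ∪ O₁.cnames) ∩ (cnames D ∪ O₂.cnames) ∧
      entails (O₁.union O₂) C I ∧ entails (O₁.union O₂) I D

/-- RIQ has the concept-based Beth definability property. -/
def CBP : Prop :=
  ∀ (C : Concept) (O : Ontology) (Θ : Finset ℕ), Θ ⊆ cnames C ∪ O.cnames →
    ImplicitlyDefinable C O Θ → ExplicitlyDefinable C O Θ

theorem Deriv.mono {O : Ontology} {Γ : Finset SAtom} {Δ : Multiset LC} {n : ℕ}
    (d : Deriv O Γ Δ n) : ∀ {m : ℕ}, n ≤ m → Deriv O Γ Δ m := by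
  induction d with
  | id Γ Δ x A n => exact fun _ => .id Γ Δ x A _
  | idEq Γ Δ x y n hmem h => exact fun _ => .idEq Γ Δ x y _ hmem h
  | subst Γ Δ x y L n hL h _ ih =>
    rintro (_ | m) hm
    · omega
    · exact .subst Γ Δ x y L m hL h (ih (by omega))
  | orR Γ Δ x C D n _ ih =>
    rintro (_ | m) hm
    · omega
    · exact .orR Γ Δ x C D m (ih (by omega))
  | andR Γ Δ x C D n _ _ ih₁ ih₂ =>
    rintro (_ | m) hm
    · omega
    · exact .andR Γ Δ x C D m (ih₁ (by omega)) (ih₂ (by omega))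
  | exR Γ Δ x y r C n h _ ih =>
    rintro (_ | m) hm
    · omega
    · exact .exR Γ Δ x y r C m h (ih (by omega))
  | allR Γ Δ x y r C n hy _ ih =>
    rintro (_ | m) hm
    · omega
    · exact .allR Γ Δ x y r C m hy (ih (by omega))
  | leR Γ Δ x r C k n ys hinj hfresh _ ih =>
    rintro (_ | m) hm
    · omega
    · exact .leR Γ Δ x r C k m ys hinj hfresh (ih (by omega))
  | geR Γ Δ x r C k n ys hpath _ _ ih₁ ih₂ =>
    rintro (_ | m) hm
    · omega
    · exact .geR Γ Δ x r C k m ys hpath (fun i => ih₁ i (by omega))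
        (fun i j hij => ih₂ i j hij (by omega))

theorem FreshLabel.of_subset {z : ℕ} {Γ Γ' : Finset SAtom} {Δ Δ' : Multiset LC}
    (h : FreshLabel z Γ' Δ') (hΓ : Γ ⊆ Γ')
    (hΔ : ∀ p ∈ Δ, p ∈ Δ' ∨ p.1 ∈ labSetF Γ' ∨ ∃ q ∈ Δ', q.1 = p.1) :
    FreshLabel z Γ Δ := by
  refine ⟨fun hz => h.1 (Finset.biUnion_subset_biUnion_of_subset_left _ hΓ hz), ?_⟩
  rintro p hp rfl
  rcases hΔ p hp with hp | hp | ⟨q, hq, e⟩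
  · exact h.2 p hp rfl
  · exact h.1 hp
  · exact h.2 q hq e

theorem FreshLabel.cons {y z : ℕ} {Γ : Finset SAtom} {Δ : Multiset LC} {D : Concept}
    (hy : FreshLabel y Γ Δ) (hz : ¬ FreshLabel z Γ Δ) : FreshLabel y Γ ((z, D) ::ₘ Δ) := by
  refine ⟨hy.1, fun p hp => ?_⟩
  rcases Multiset.mem_cons.1 hp with rfl | hp
  · rintro rfl
    exact hz hy
  · exact hy.2 p hp

theorem Deriv.weaken {O : Ontology} {Γ : Finset SAtom} {Δ : Multiset LC} {n : ℕ}
    (d : Deriv O Γ Δ n) {z : ℕ} (D : Concept) (hz : ¬ FreshLabel z Γ Δ) :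
    Deriv O Γ ((z, D) ::ₘ Δ) n := by
  induction d with
  | id Γ Δ x A n =>
    have := Deriv.id (O := O) Γ ((z, D) ::ₘ Δ) x A n
    rwa [Multiset.cons_swap _ (z, D), Multiset.cons_swap _ (z, D)] at this
  | idEq Γ Δ x y n hmem h => exact .idEq Γ _ x y _ hmem h
  | subst Γ Δ x y L n hL h _ ih =>
    rw [Multiset.cons_swap]
    refine .subst Γ _ x y L n hL h ?_
    rw [Multiset.cons_swap _ (z, D), Multiset.cons_swap _ (z, D)]
    exact ih fun hf => hz (hf.of_subset subset_rfl (by simp +contextual))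
  | orR Γ Δ x C D' n _ ih =>
    rw [Multiset.cons_swap]
    refine .orR Γ _ x C D' n ?_
    rw [Multiset.cons_swap _ (z, D), Multiset.cons_swap _ (z, D)]
    exact ih fun hf => hz (hf.of_subset subset_rfl (by simp +contextual))
  | andR Γ Δ x C D' n _ _ ih₁ ih₂ =>
    rw [Multiset.cons_swap]
    refine .andR Γ _ x C D' n ?_ ?_ <;> rw [Multiset.cons_swap _ (z, D)]
    · exact ih₁ fun hf => hz (hf.of_subset subset_rfl (by simp +contextual))
    · exact ih₂ fun hf => hz (hf.of_subset subset_rfl (by simp +contextual))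
  | exR Γ Δ x y r C n h _ ih =>
    rw [Multiset.cons_swap]
    refine .exR Γ _ x y r C n h ?_
    rw [Multiset.cons_swap _ (z, D), Multiset.cons_swap _ (z, D)]
    exact ih fun hf => hz (hf.of_subset subset_rfl (by simp +contextual))
  | allR Γ Δ x y r C n hy _ ih =>
    have hy' := hy.cons (D := D) hz
    rw [Multiset.cons_swap] at hy' ⊢
    refine .allR Γ _ x y r C n hy' ?_
    rw [Multiset.add_cons, Multiset.cons_swap _ (z, D)]
    refine ih fun hf => hz (hf.of_subset (Finset.subset_insert _ _) ?_)
    simp +contextual [labSetF, SAtom.labels]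
  | leR Γ Δ x r C k n ys hinj hfresh _ ih =>
    have hfresh' := fun i => (hfresh i).cons (D := D) hz
    rw [Multiset.cons_swap] at hfresh' ⊢
    refine .leR Γ _ x r C k n ys hinj hfresh' ?_
    rw [Multiset.add_cons]
    refine ih fun hf => hz (hf.of_subset ?_ ?_)
    · rw [Finset.union_assoc]
      exact Finset.subset_union_left
    · intro p hp
      rcases Multiset.mem_cons.1 hp with rfl | hp
      · refine .inr (.inl (Finset.mem_biUnion.2 ⟨.rel r x (ys 0), ?_, by simp [SAtom.labels]⟩))
        simp [relSet]
      · exact .inl (Multiset.mem_add.2 (.inr hp))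
  | geR Γ Δ x r C k n ys hpath _ _ ih₁ ih₂ =>
    rw [Multiset.cons_swap]
    refine .geR Γ _ x r C k n ys hpath (fun i => ?_) (fun i j hij => ?_)
    · rw [Multiset.cons_swap _ (z, D), Multiset.cons_swap _ (z, D)]
      exact ih₁ i fun hf => hz (hf.of_subset subset_rfl (by simp +contextual))
    · rw [Multiset.cons_swap _ (z, D)]
      exact ih₂ i j hij fun hf =>
        hz (hf.of_subset (Finset.subset_insert _ _) (by simp +contextual))

theorem SProvable.weaken_multiset {O : Ontology} {Γ : Finset SAtom} {Δ : Multiset LC}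
    (h : SProvable O Γ Δ) (W : Multiset LC) (hW : ∀ p ∈ W, ¬ FreshLabel p.1 Γ Δ) :
    SProvable O Γ (W + Δ) := by
  induction W using Multiset.induction with
  | empty => simpa using h
  | cons p W ih =>
    obtain ⟨n, d⟩ := ih fun q hq => hW q (Multiset.mem_cons_of_mem hq)
    rw [Multiset.cons_add]
    refine ⟨n, d.weaken p.2 fun hf => hW p (Multiset.mem_cons_self p W) ?_⟩
    exact hf.of_subset subset_rfl (by simp +contextual)

theorem SProvable.inter {O : Ontology} {Γ : Finset SAtom} {Δ : Multiset LC} {x : ℕ}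
    {C D : Concept} (hC : SProvable O Γ ((x, C) ::ₘ Δ)) (hD : SProvable O Γ ((x, D) ::ₘ Δ)) :
    SProvable O Γ ((x, .inter C D) ::ₘ Δ) := by
  obtain ⟨n, c⟩ := hC
  obtain ⟨m, d⟩ := hD
  exact ⟨_, .andR Γ Δ x C D (max n m) (c.mono (le_max_left n m)) (d.mono (le_max_right n m))⟩

theorem SProvable.neg_bigUnionL {O : Ontology} {Γ : Finset SAtom} {Δ : Multiset LC} {x : ℕ} :
    ∀ {S : List Concept}, S ≠ [] → (∀ C ∈ S, SProvable O Γ ((x, nnfNeg C) ::ₘ Δ)) →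
      SProvable O Γ ((x, nnfNeg (bigUnionL S)) ::ₘ Δ)
  | [], hS, _ => absurd rfl hS
  | [C], _, h => h C (by simp)
  | C :: D :: S, _, h =>
    (h C (by simp)).inter
      (neg_bigUnionL (S := D :: S) (by simp) fun E hE => h E (List.mem_cons_of_mem _ hE))

/-- To prove the negation of `⊓⊔G`, it suffices to prove, for every way of choosing one
disjunct from each member of `G`, the sequent containing the negations of all choices. -/
theorem SProvable.neg_interUnion {O : Ontology} {Γ : Finset SAtom} {x : ℕ} :
    ∀ {G : List (List Concept)} {Δ : Multiset LC}, G ≠ [] → (∀ S ∈ G, S ≠ []) →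
      (∀ L : List Concept, List.Forall₂ (· ∈ ·) L G →
        SProvable O Γ (((L.map fun C => (x, nnfNeg C) : List LC) : Multiset LC) + Δ)) →
      SProvable O Γ ((x, nnfNeg (interUnion G)) ::ₘ Δ)
  | [], _, hG, _, _ => absurd rfl hG
  | [S], _, _, hS, h =>
    neg_bigUnionL (hS S (by simp)) fun C hC => by simpa using h [C] (by simpa using hC)
  | S :: T :: G, Δ, _, hS, h => by
    obtain ⟨n, d⟩ : SProvable O Γ ((x, nnfNeg (bigUnionL S)) ::ₘ
        (x, nnfNeg (interUnion (T :: G))) ::ₘ Δ) := by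
      refine neg_bigUnionL (hS S (by simp)) fun C hC => ?_
      rw [Multiset.cons_swap]
      refine neg_interUnion (by simp) (fun S' hS' => hS S' (List.mem_cons_of_mem _ hS'))
        fun L hL => ?_
      simpa [← Multiset.cons_coe] using h (C :: L) (.cons hC hL)
    exact ⟨_, .orR Γ Δ x _ _ n d⟩

/-- if Γ ⊢ Δ, Σ is provable in S(O) for every (⊢ Σ) ∈ 𝒢^⊥, then
S(O) ⊩ Γ ⊢ Δ, x : ¬̇(⊓⊔𝒢). -/
theorem interpolant_neg_conj_disj (O : Ontology) (Γ : Finset SAtom) (Δ : Multiset LC)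
    (x : ℕ) (G : List (List Concept))
    (hG : G ≠ []) (hG' : ∀ S ∈ G, S ≠ [])
    (hprov : ∀ Sf : Finset LC, ((∅, Sf) : ISeq) ∈ OrthP (simpleG x G) →
      SProvable O Γ (Δ + Sf.val)) :
    SProvable O Γ ((x, nnfNeg (interUnion G)) ::ₘ Δ) := by
  refine SProvable.neg_interUnion hG hG' fun L hL => ?_
  set M : Multiset LC := ((L.map fun C => (x, nnfNeg C) : List LC) : Multiset LC) with hM
  have hMx : ∀ p ∈ M, p.1 = x := by
    intro p hp
    simp only [hM, Multiset.mem_coe, List.mem_map] at hp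
    obtain ⟨C, -, rfl⟩ := hp
    rfl
  have hchoice : ∀ S ∈ G, ∃ C ∈ S, (x, nnfNeg C) ∈ M := by
    intro S hS
    obtain ⟨i, hi, rfl⟩ := List.getElem_of_mem hS
    have hi' : i < L.length := hL.length_eq ▸ hi
    exact ⟨L[i], hL.get hi' hi, by simpa [hM] using ⟨L[i], List.getElem_mem hi', rfl⟩⟩
  obtain ⟨W, hW⟩ := Multiset.le_iff_exists_add.1 (Multiset.dedup_le M)
  have hdedup : SProvable O Γ (Δ + M.dedup) := by
    refine hprov M.toFinset ?_
    rintro _ ⟨S, hS, rfl⟩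
    obtain ⟨C, hC, hCM⟩ := hchoice S hS
    exact .inr (.inr ⟨by simp, by simp, x, C, by simpa using hCM, by simpa using hC⟩)
  obtain ⟨S, hS⟩ := List.exists_mem_of_ne_nil G hG
  obtain ⟨C, -, hCM⟩ := hchoice S hS
  have hsum : M + Δ = W + (Δ + M.dedup) := by
    nth_rewrite 1 [hW]
    abel
  rw [hsum]
  refine hdedup.weaken_multiset W fun p hp hf => ?_
  refine hf.2 (x, nnfNeg C) (by simp [hCM]) (hMx p ?_).symm
  rw [hW]
  exact Multiset.mem_add.2 (.inr hp)

end RIQ
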